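/- Convergence in D+1 iterations (Theorem 3): let D be the finite digraph diameter, i.e. the maximum of dist(u,v) over all ordered pairs (u,v) with u reaching v. Then for every k ∈ ℕ, the global stabilization condition (X (k+1) i = X k i for all vertices i) holds if and only if k ≥ D; in particular X D i = reach(i) for all i, and for every k < D there exists a vertex i with X k i ⊊ X (k+1) i. -/

import Mathlib

open scoped Classical

variable {V : Type*}

/-- Walks of length exactly `n`: `stepRel Adj n u v` means there is a directed walk
from `u` to `v` of length `n`. -/
def stepRel (Adj : V → V → Prop) : ℕ → V → V → Prop
  | 0 => Eq
  | (n+1) => fun u v => ∃ w, Adj u w ∧ stepRel Adj n w v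

/-- `ddist Adj u v` is the minimum length of a directed walk from `u` to `v`
(meaningful when `u` reaches `v`). -/
noncomputable def ddist (Adj : V → V → Prop) (u v : V) : ℕ :=
  sInf {n | stepRel Adj n u v}

/-- `reachSet Adj v` is the finite set of vertices that reach `v`. -/
noncomputable def reachSet [Fintype V] (Adj : V → V → Prop) (v : V) : Finset V :=
  Finset.univ.filter (fun u => Relation.ReflTransGen Adj u v)

/-- In-eccentricity: the maximum of `ddist Adj j i` over all `j` reaching `i`. -/
noncomputable def ecc [Fintype V] (Adj : V → V → Prop) (i : V) : ℕ :=
  (Finset.univ.filter (fun j => Relation.ReflTransGen Adj j i)).sup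
    (fun j => ddist Adj j i)

/-- Finite digraph diameter: maximum of `ddist Adj u v` over ordered pairs `(u, v)`
with `u` reaching `v`. -/
noncomputable def fdiam [Fintype V] (Adj : V → V → Prop) : ℕ :=
  (Finset.univ.filter (fun p : V × V => Relation.ReflTransGen Adj p.1 p.2)).sup
    (fun p => ddist Adj p.1 p.2)

/-- Algorithm 1's flooding iteration: `flood Adj 0 i = {i}` and
`flood Adj (k+1) i = flood Adj k i ∪ ⋃_{j with Adj j i} flood Adj k j`. -/
noncomputable def flood [Fintype V] [DecidableEq V] (Adj : V → V → Prop) : ℕ → V → Finset V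
  | 0, i => {i}
  | (k+1), i => flood Adj k i ∪
      (Finset.univ.filter (fun j => Adj j i)).biUnion (fun j => flood Adj k j)

theorem stepRel_succ_iff (Adj : V → V → Prop) (n : ℕ) (u v : V) :
    stepRel Adj (n + 1) u v ↔ ∃ w, stepRel Adj n u w ∧ Adj w v := by
  induction n generalizing u with
  | zero => simp [stepRel]
  | succ n ih =>
    constructor
    · rintro ⟨w, huw, hwv⟩
      obtain ⟨x, hwx, hxv⟩ := (ih w).1 hwv
      exact ⟨x, ⟨w, huw, hwx⟩, hxv⟩
    · rintro ⟨x, ⟨w, huw, hwx⟩, hxv⟩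
      exact ⟨w, huw, (ih w).2 ⟨x, hwx, hxv⟩⟩

theorem reflTransGen_iff_exists_stepRel (Adj : V → V → Prop) (u v : V) :
    Relation.ReflTransGen Adj u v ↔ ∃ n, stepRel Adj n u v := by
  constructor
  · intro h
    induction h with
    | refl => exact ⟨0, rfl⟩
    | tail _ hbc ih =>
      obtain ⟨n, hn⟩ := ih
      exact ⟨n + 1, (stepRel_succ_iff Adj n u _).2 ⟨_, hn, hbc⟩⟩
  · rintro ⟨n, hn⟩
    induction n generalizing u with
    | zero => exact Eq.subst hn .refl
    | succ n ih =>
      obtain ⟨w, huw, hwv⟩ := hn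
      exact .head huw (ih w hwv)

theorem mem_flood_iff_exists_stepRel [Fintype V] [DecidableEq V] (Adj : V → V → Prop)
    (k : ℕ) (i j : V) : j ∈ flood Adj k i ↔ ∃ n ≤ k, stepRel Adj n j i := by
  induction k generalizing i with
  | zero => simp [flood, stepRel]
  | succ k ih =>
    simp only [flood, Finset.mem_union, Finset.mem_biUnion, Finset.mem_filter,
      Finset.mem_univ, true_and, ih]
    constructor
    · rintro (⟨n, hn, h⟩ | ⟨w, hw, n, hn, h⟩)
      · exact ⟨n, by omega, h⟩
      · exact ⟨n + 1, by omega, (stepRel_succ_iff Adj n j i).2 ⟨w, h, hw⟩⟩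
    · rintro ⟨n, hn, h⟩
      rcases Nat.le_succ_iff.1 hn with hk | rfl
      · exact .inl ⟨n, hk, h⟩
      · obtain ⟨w, h, hw⟩ := (stepRel_succ_iff Adj k j i).1 h
        exact .inr ⟨w, hw, k, le_rfl, h⟩

theorem mem_flood_iff_ddist_le [Fintype V] [DecidableEq V] (Adj : V → V → Prop)
    (k : ℕ) (i j : V) :
    j ∈ flood Adj k i ↔ Relation.ReflTransGen Adj j i ∧ ddist Adj j i ≤ k := by
  rw [mem_flood_iff_exists_stepRel, reflTransGen_iff_exists_stepRel]
  constructor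
  · rintro ⟨n, hn, h⟩
    exact ⟨⟨n, h⟩, (Nat.sInf_le h).trans hn⟩
  · rintro ⟨h, hk⟩
    exact ⟨ddist Adj j i, hk, Nat.sInf_mem h⟩

theorem fdiam_le_iff [Fintype V] (Adj : V → V → Prop) (k : ℕ) :
    fdiam Adj ≤ k ↔ ∀ u v, Relation.ReflTransGen Adj u v → ddist Adj u v ≤ k := by
  simp [fdiam, Finset.sup_le_iff]

theorem flood_eq_reachSet [Fintype V] [DecidableEq V] {Adj : V → V → Prop} {k : ℕ}
    (hk : fdiam Adj ≤ k) (i : V) : flood Adj k i = reachSet Adj i := by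
  ext j
  simpa [mem_flood_iff_ddist_le, reachSet] using (fdiam_le_iff Adj k).1 hk j i

theorem fdiam_le_of_flood_succ_eq [Fintype V] [DecidableEq V] {Adj : V → V → Prop} {k : ℕ}
    (h : ∀ i, flood Adj (k + 1) i = flood Adj k i) : fdiam Adj ≤ k := by
  refine (fdiam_le_iff Adj k).2 fun u v huv => ((mem_flood_iff_ddist_le Adj k v u).1 ?_).2
  induction huv with
  | refl => exact (mem_flood_iff_exists_stepRel Adj k u u).2 ⟨0, k.zero_le, rfl⟩
  | @tail b c _ hbc ih =>
    rw [← h c, flood]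
    exact Finset.mem_union_right _
      (Finset.mem_biUnion.2 ⟨b, Finset.mem_filter.2 ⟨Finset.mem_univ b, hbc⟩, ih⟩)

theorem flood_succ_eq_iff [Fintype V] [DecidableEq V] (Adj : V → V → Prop) (k : ℕ) :
    (∀ i, flood Adj (k + 1) i = flood Adj k i) ↔ fdiam Adj ≤ k :=
  ⟨fdiam_le_of_flood_succ_eq, fun hk i =>
    (flood_eq_reachSet (hk.trans k.le_succ) i).trans (flood_eq_reachSet hk i).symm⟩

/-- Theorem 3, convergence in `D+1` iterations: global stabilization
at step `k` holds iff `k ≥ D`; in particular `X D i = reach(i)` for all `i`, and for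
every `k < D` some vertex strictly gains information. -/
theorem stmt12 [Fintype V] [DecidableEq V] (Adj : V → V → Prop) :
    (∀ k : ℕ, (∀ i : V, flood Adj (k+1) i = flood Adj k i) ↔ k ≥ fdiam Adj) ∧
    (∀ i : V, flood Adj (fdiam Adj) i = reachSet Adj i) ∧
    (∀ k < fdiam Adj, ∃ i : V, flood Adj k i ⊂ flood Adj (k+1) i) := by
  refine ⟨flood_succ_eq_iff Adj, flood_eq_reachSet le_rfl, fun k hk => ?_⟩
  obtain ⟨i, hi⟩ := not_forall.1 (mt (flood_succ_eq_iff Adj k).1 hk.not_ge)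
  exact ⟨i, Finset.ssubset_iff_subset_ne.2 ⟨Finset.subset_union_left, Ne.symm hi⟩⟩
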